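/- Weak regularity lemma: For every prime p, every n, every δ > 0, and every function f : 𝔽_p^n → [0,1], there is a subspace H of 𝔽_p^n of codimension ⌊δ^{-2}⌋ (assuming n ≥ ⌊δ^{-2}⌋) that is δ-weakly-regular with respect to f; that is, for every character χ of 𝔽_p^n one has |\widehat{(f − f_H)}(χ)| ≤ δ, where f_H(x) = 𝔼_{y ∈ H+x}[f(y)]. -/

import Mathlib

/-- The Fourier transform of `g : 𝔽_p^n → ℂ` at the character indexed by `t ∈ 𝔽_p^n`:
`ĝ(t) = (1/p^n) ∑_x g(x) ω^(t·x)` with `ω = e^(2πi/p)`. -/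
noncomputable def dft {p n : ℕ} [NeZero p] (g : (Fin n → ZMod p) → ℂ)
    (t : Fin n → ZMod p) : ℂ :=
  (1 / (p : ℂ) ^ n) * ∑ x : Fin n → ZMod p,
    g x * Complex.exp (2 * Real.pi * Complex.I * (((∑ i, t i * x i : ZMod p)).val : ℂ) / p)

/-- The averaged function `f_H(x) = 𝔼_{y ∈ H + x} f(y)` of `f` with respect to the
subspace `H`. -/
noncomputable def cosetAvg {p n : ℕ} [NeZero p] (H : Submodule (ZMod p) (Fin n → ZMod p))
    (f : (Fin n → ZMod p) → ℝ) (x : Fin n → ZMod p) : ℝ :=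
  haveI := Fintype.ofFinite H
  (∑ h : H, f (x + h)) / (Nat.card H : ℝ)

theorem dft_eq_sum_stdAddChar {p n : ℕ} [NeZero p] (g : (Fin n → ZMod p) → ℂ)
    (t : Fin n → ZMod p) :
    dft g t = (1 / (p : ℂ) ^ n) * ∑ x, g x * ZMod.stdAddChar (t ⬝ᵥ x) := by
  simp only [dft, ZMod.stdAddChar_apply, ZMod.toCircle_apply, dotProduct]

theorem sum_stdAddChar_dotProduct {p n : ℕ} [Fact p.Prime] (z : Fin n → ZMod p) :
    ∑ t : Fin n → ZMod p, (ZMod.stdAddChar (t ⬝ᵥ z) : ℂ) = if z = 0 then (p : ℂ) ^ n else 0 := by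
  split_ifs with hz
  · simp [hz, ZMod.card]
  · obtain ⟨i, hi⟩ := Function.ne_iff.1 hz
    let ψ : AddChar (Fin n → ZMod p) ℂ :=
      { toFun := fun t => ZMod.stdAddChar (t ⬝ᵥ z)
        map_zero_eq_one' := by simp
        map_add_eq_mul' := fun a b => by simp [add_dotProduct, AddChar.map_add_eq_mul] }
    refine AddChar.sum_eq_zero_of_ne_one (ψ := ψ) (AddChar.ne_one_iff.2 ⟨Pi.single i (z i)⁻¹, ?_⟩)
    change ZMod.stdAddChar (Pi.single i (z i)⁻¹ ⬝ᵥ z) ≠ (1 : ℂ)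
    rw [single_dotProduct, inv_mul_cancel₀ hi, ← AddChar.map_zero_eq_one (ZMod.stdAddChar (N := p))]
    exact ZMod.injective_stdAddChar.ne one_ne_zero

/-- Parseval's identity on `𝔽_p^n`. -/
theorem sum_norm_dft_sq {p n : ℕ} [Fact p.Prime] (g : (Fin n → ZMod p) → ℂ) :
    ∑ t, ‖dft g t‖ ^ 2 = (1 / (p : ℝ) ^ n) * ∑ x, ‖g x‖ ^ 2 := by
  have hp : (p : ℂ) ≠ 0 := Nat.cast_ne_zero.2 (Fact.out : p.Prime).ne_zero
  have key (t : Fin n → ZMod p) : ((‖dft g t‖ : ℂ)) ^ 2 =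
      ∑ x, ∑ y, (1 / (p : ℂ) ^ n) ^ 2 * (g x * (starRingEnd ℂ) (g y)) *
        ZMod.stdAddChar (t ⬝ᵥ (x - y)) := by
    rw [← Complex.mul_conj', dft_eq_sum_stdAddChar, map_mul, map_sum, mul_mul_mul_comm,
      Finset.sum_mul_sum, Finset.mul_sum]
    refine Finset.sum_congr rfl fun x _ => ?_
    rw [Finset.mul_sum]
    refine Finset.sum_congr rfl fun y _ => ?_
    rw [dotProduct_sub, sub_eq_add_neg, AddChar.map_add_eq_mul, AddChar.map_neg_eq_conj]
    simp only [map_mul, map_div₀, map_one, map_pow, Complex.conj_natCast]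
    ring
  apply Complex.ofReal_injective
  push_cast
  simp_rw [key]
  rw [Finset.sum_comm, Finset.mul_sum]
  refine Finset.sum_congr rfl fun x _ => ?_
  rw [Finset.sum_comm]
  simp_rw [← Finset.mul_sum, sum_stdAddChar_dotProduct, sub_eq_zero, mul_ite, mul_zero]
  rw [Finset.sum_ite_eq Finset.univ x, if_pos (Finset.mem_univ x), Complex.mul_conj']
  field_simp

/-- A bounded function has few large Fourier coefficients. -/
theorem card_le_of_lt_norm_dft {p n : ℕ} [Fact p.Prime] {δ : ℝ} (hδ : 0 < δ)
    {g : (Fin n → ZMod p) → ℂ} (hg : ∀ x, ‖g x‖ ≤ 1) {S : Finset (Fin n → ZMod p)}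
    (hS : ∀ t ∈ S, δ < ‖dft g t‖) : S.card ≤ ⌊(δ ^ 2)⁻¹⌋₊ := by
  have hp : (0 : ℝ) < p := Nat.cast_pos.2 (Fact.out : p.Prime).pos
  have h_card : S.card * δ ^ 2 ≤ ∑ t, ‖dft g t‖ ^ 2 := calc
    S.card * δ ^ 2 = ∑ _t ∈ S, δ ^ 2 := by simp
    _ ≤ ∑ t ∈ S, ‖dft g t‖ ^ 2 := Finset.sum_le_sum fun t ht => by
      gcongr
      exact (hS t ht).le
    _ ≤ ∑ t, ‖dft g t‖ ^ 2 :=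
      Finset.sum_le_sum_of_subset_of_nonneg (Finset.subset_univ _) fun _ _ _ => by positivity
  have h_sum : ∑ x, ‖g x‖ ^ 2 ≤ (p : ℝ) ^ n := calc
    ∑ x, ‖g x‖ ^ 2 ≤ ∑ _x : Fin n → ZMod p, (1 : ℝ) :=
      Finset.sum_le_sum fun x _ => pow_le_one₀ (norm_nonneg _) (hg x)
    _ = (p : ℝ) ^ n := by simp [ZMod.card]
  rw [sum_norm_dft_sq] at h_card
  refine Nat.le_floor ?_
  rw [← one_div, le_div_iff₀ (by positivity)]
  refine h_card.trans ?_
  rw [one_div, ← div_eq_inv_mul]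
  exact (div_le_one (by positivity)).2 h_sum

theorem exists_submodule_finrank_eq_sub {K : Type*} [Field K] {n k : ℕ}
    {S : Finset (Fin n → K)} (hS : S.card ≤ k) :
    ∃ H : Submodule K (Fin n → K), Module.finrank K H = n - k ∧
      ∀ t ∈ S, ∀ h ∈ H, t ⬝ᵥ h = 0 := by
  let A : (Fin n → K) →ₗ[K] (S → K) := LinearMap.pi fun t => dotProductBilin K K t.1
  have hA : n - k ≤ Module.finrank K A.ker := by
    have h1 := A.finrank_range_add_finrank_ker
    have h2 := A.range.finrank_le
    rw [Module.finrank_fin_fun] at h1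
    rw [Module.finrank_fintype_fun_eq_card, Fintype.card_coe] at h2
    omega
  obtain ⟨s, hs, hli⟩ := exists_finset_linearIndependent_of_le_finrank hA
  refine ⟨(Submodule.span K (s : Set A.ker)).map A.ker.subtype, ?_, ?_⟩
  · rw [Submodule.finrank_map_subtype_eq, finrank_span_finset_eq_card hli, hs]
  · rintro t ht _ ⟨h, -, rfl⟩
    exact congrFun (LinearMap.mem_ker.1 h.2) ⟨t, ht⟩

open Classical in
/-- Averaging over cosets of `H` restricts the Fourier transform to the annihilator of `H`. -/
theorem dft_cosetAvg {p n : ℕ} [NeZero p] (H : Submodule (ZMod p) (Fin n → ZMod p))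
    (f : (Fin n → ZMod p) → ℝ) (t : Fin n → ZMod p) :
    dft (fun x => (cosetAvg H f x : ℂ)) t =
      if ∀ h ∈ H, t ⬝ᵥ h = 0 then dft (fun x => (f x : ℂ)) t else 0 := by
  let := Fintype.ofFinite H
  have h_shift (h : H) : ∑ x, (f (x + h) : ℂ) * ZMod.stdAddChar (t ⬝ᵥ x) =
      (∑ x, (f x : ℂ) * ZMod.stdAddChar (t ⬝ᵥ x)) * ZMod.stdAddChar (-(t ⬝ᵥ h)) := by
    rw [← Equiv.sum_comp (Equiv.addRight (h : Fin n → ZMod p))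
      (fun x => (f x : ℂ) * ZMod.stdAddChar (t ⬝ᵥ x)), Finset.sum_mul]
    refine Finset.sum_congr rfl fun x _ => ?_
    rw [Equiv.coe_addRight, mul_assoc, ← AddChar.map_add_eq_mul, dotProduct_add,
      add_neg_cancel_right]
  have h_fact : dft (fun x => (cosetAvg H f x : ℂ)) t = dft (fun x => (f x : ℂ)) t *
      ((∑ h : H, (ZMod.stdAddChar (-(t ⬝ᵥ h)) : ℂ)) / Nat.card H) := by
    simp only [dft_eq_sum_stdAddChar, cosetAvg]
    push_cast
    simp_rw [div_mul_eq_mul_div, Finset.sum_mul]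
    rw [← Finset.sum_div, Finset.sum_comm]
    simp_rw [h_shift]
    rw [← Finset.mul_sum]
    ring
  rw [h_fact]
  split_ifs with ht
  · have hc : (Nat.card H : ℂ) ≠ 0 := Nat.cast_ne_zero.2 Nat.card_pos.ne'
    have h_one (h : H) : (ZMod.stdAddChar (-(t ⬝ᵥ h)) : ℂ) = 1 := by simp [ht h h.2]
    simp_rw [h_one]
    rw [Finset.sum_const, Finset.card_univ, ← Nat.card_eq_fintype_card, nsmul_eq_mul, mul_one,
      div_self hc, mul_one]
  · push Not at ht
    obtain ⟨h, hH, hh⟩ := ht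
    let ψ : AddChar H ℂ :=
      { toFun := fun h => ZMod.stdAddChar (-(t ⬝ᵥ h))
        map_zero_eq_one' := by simp
        map_add_eq_mul' := fun a b => by
          rw [Submodule.coe_add, dotProduct_add, neg_add, AddChar.map_add_eq_mul] }
    have h_ne : ψ ≠ 1 := by
      refine AddChar.ne_one_iff.2 ⟨⟨h, hH⟩, ?_⟩
      change ZMod.stdAddChar (-(t ⬝ᵥ h)) ≠ (1 : ℂ)
      rw [← AddChar.map_zero_eq_one (ZMod.stdAddChar (N := p))]
      exact ZMod.injective_stdAddChar.ne (neg_ne_zero.2 hh)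
    have h_zero : ∑ h : H, (ZMod.stdAddChar (-(t ⬝ᵥ h)) : ℂ) = 0 :=
      AddChar.sum_eq_zero_of_ne_one h_ne
    rw [h_zero, zero_div, mul_zero]

/-- Weak regularity lemma. For every prime `p`, every `n`, every
`δ > 0` and every `f : 𝔽_p^n → [0,1]`, there is a subspace `H` of `𝔽_p^n` of
codimension `⌊δ⁻²⌋` (assuming `n ≥ ⌊δ⁻²⌋`) which is `δ`-weakly-regular with respect
to `f`: for every character `χ` of `𝔽_p^n`, `|(f - f_H)^(χ)| ≤ δ`. -/
theorem weak_regularity (p : ℕ) [Fact p.Prime] (n : ℕ) (δ : ℝ) (hδ : 0 < δ)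
    (hn : ⌊(δ ^ 2)⁻¹⌋₊ ≤ n) (f : (Fin n → ZMod p) → ℝ)
    (hf : ∀ x, f x ∈ Set.Icc (0 : ℝ) 1) :
    ∃ H : Submodule (ZMod p) (Fin n → ZMod p),
      Module.finrank (ZMod p) H = n - ⌊(δ ^ 2)⁻¹⌋₊ ∧
      ∀ t : Fin n → ZMod p,
        ‖dft (fun x => (f x : ℂ) - (cosetAvg H f x : ℂ)) t‖ ≤ δ := by
  classical
  obtain ⟨H, hH, hS⟩ := exists_submodule_finrank_eq_sub
    (S := {t | δ < ‖dft (fun x => (f x : ℂ)) t‖})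
    (card_le_of_lt_norm_dft hδ (g := fun x => (f x : ℂ))
      (fun x => by
        rw [Complex.norm_real, Real.norm_of_nonneg (hf x).1]
        exact (hf x).2)
      fun t ht => (Finset.mem_filter.1 ht).2)
  refine ⟨H, hH, fun t => ?_⟩
  have h_sub : dft (fun x => (f x : ℂ) - (cosetAvg H f x : ℂ)) t =
      dft (fun x => (f x : ℂ)) t - dft (fun x => (cosetAvg H f x : ℂ)) t := by
    simp only [dft, sub_mul, Finset.sum_sub_distrib, mul_sub]
  rw [h_sub, dft_cosetAvg]
  split_ifs with ht
  · simpa using hδ.le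
  · rw [sub_zero]
    by_contra! h_lt
    exact ht (hS t (Finset.mem_filter.2 ⟨Finset.mem_univ t, h_lt⟩))
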